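/- Let (R,m,K) be a commutative Noetherian local ring with maximal ideal m and residue field K = R/m, and let M be an R-module. Then the following are equivalent: (a) dim_K Ext^j_R(K, M) is finite for all j ≥ 0; (b) Ext^j_R(N, M) has finite length as an R-module for every R-module N of finite length and all j ≥ 0; (c) there exists a nonzero R-module N of finite length such that Ext^j_R(N, M) has finite length for all j ≥ 0. -/

import Mathlib

universe u
open CategoryTheory IsLocalRing
namespace BassAux
open CategoryTheory.Abelian

lemma extMk_zero_iff {R : Type u} [CommRing R] {X Y : ModuleCat.{u} R} (P : ProjectiveResolution X)
    (f : P.complex.X 0 ⟶ Y) (hf : P.complex.d 1 0 ≫ f = 0) :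
    P.extMk f 1 rfl hf = 0 ↔ f = 0 := by
  constructor
  · intro h
    rw [← P.extEquivCohomologyClass.apply_eq_iff_eq,
      ProjectiveResolution.extEquivCohomologyClass_extMk,
      ProjectiveResolution.extEquivCohomologyClass_zero,
      CochainComplex.HomComplex.CohomologyClass.mk_eq_zero_iff,
      CochainComplex.HomComplex.Cocycle.toSingleMk_mem_coboundaries_iff _ _ _ _ _ 1 (by simp)] at h
    obtain ⟨g, hg⟩ := h
    have hz : Limits.IsZero (P.cochainComplex.X 1) :=
      P.cochainComplex.isZero_of_isStrictlyLE 0 1 (by simp)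
    rw [hz.eq_of_src g 0, Limits.comp_zero] at hg
    rw [← cancel_epi (P.cochainComplexXIso (-(0 : ℕ)) 0 rfl).hom, ← hg, Limits.comp_zero]
  · rintro rfl
    exact P.extMk_zero 1 rfl

variable {R : Type u} [CommRing R] {X : ModuleCat.{u} R} (P : ProjectiveResolution X)
  (Y : ModuleCat.{u} R) (n : ℕ)

noncomputable abbrev cplx := (P.complex.linearYonedaObj R Y)

noncomputable abbrev sc := (cplx P Y).sc' ((ComplexShape.up ℕ).prev n) n (n+1)

lemma sc_g_apply (f : P.complex.X n ⟶ Y) : (sc P Y n).g.hom f = P.complex.d (n+1) n ≫ f := rfl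
lemma sc_f_apply (f : P.complex.X ((ComplexShape.up ℕ).prev n) ⟶ Y) :
  (sc P Y n).f.hom f = P.complex.d n ((ComplexShape.up ℕ).prev n) ≫ f := rfl

lemma extMk_smul (r : R) (f : P.complex.X n ⟶ Y) (hf : P.complex.d (n+1) n ≫ f = 0) :
    P.extMk (r • f) (n+1) rfl (by simp [hf]) = r • P.extMk f (n+1) rfl hf := by
  rw [Ext.smul_eq_comp_mk₀, P.extMk_comp_mk₀]
  simp

lemma extMk_eq_zero (f : P.complex.X n ⟶ Y) (hf : P.complex.d (n+1) n ≫ f = 0) :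
    P.extMk f (n+1) rfl hf = 0 ↔ ∃ g : P.complex.X ((ComplexShape.up ℕ).prev n) ⟶ Y,
        P.complex.d n ((ComplexShape.up ℕ).prev n) ≫ g = f := by
  cases n with
  | zero =>
    refine (extMk_zero_iff P f hf).trans ?_
    constructor
    · rintro rfl
      exact ⟨0, by simp⟩
    · rintro ⟨g, rfl⟩
      rw [P.complex.shape _ _ (by simp), Limits.zero_comp]
  | succ k =>
    have : (ComplexShape.up ℕ).prev (k+1) = k := by simp
    rw [this]
    exact P.extMk_eq_zero_iff f _ rfl hf k rfl

noncomputable def toExt : LinearMap.ker (sc P Y n).g.hom →ₗ[R] Abelian.Ext.{u} X Y n where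
  toFun f := P.extMk f.1 (n+1) rfl f.2
  map_add' f g := (P.add_extMk f.1 g.1 (n+1) rfl f.2 g.2).symm
  map_smul' r f := extMk_smul P Y n r f.1 f.2

lemma toExt_surj : Function.Surjective (toExt P Y n) := by
  intro a
  obtain ⟨f, hf, h⟩ := P.extMk_surjective a (n+1) rfl
  exact ⟨⟨f, hf⟩, h⟩

lemma toExt_ker : LinearMap.ker (toExt P Y n) = LinearMap.range (sc P Y n).moduleCatToCycles := by
  ext ⟨f, hf⟩
  change P.extMk f (n+1) rfl hf = 0 ↔ _
  have key : (⟨f, hf⟩ : LinearMap.ker (sc P Y n).g.hom) ∈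
      LinearMap.range (sc P Y n).moduleCatToCycles ↔
      ∃ g : P.complex.X ((ComplexShape.up ℕ).prev n) ⟶ Y,
        P.complex.d n ((ComplexShape.up ℕ).prev n) ≫ g = f := by
    constructor
    · rintro ⟨g, hg⟩
      exact ⟨g, congrArg Subtype.val hg⟩
    · rintro ⟨g, hg⟩
      exact ⟨g, Subtype.ext hg⟩
  exact (extMk_eq_zero P Y n f hf).trans key.symm

noncomputable def extEquiv :
    (((Ext R (ModuleCat.{u} R) n).obj (Opposite.op X)).obj Y) ≃ₗ[R] Abelian.Ext.{u} X Y n :=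
  (P.isoExt n Y ≪≫ (cplx P Y).homologyIsoSc' _ n (n+1) rfl (by simp) ≪≫
    (sc P Y n).moduleCatHomologyIso).toLinearEquiv ≪≫ₗ
    (Submodule.quotEquivOfEq _ _ (toExt_ker P Y n).symm ≪≫ₗ
      (toExt P Y n).quotKerEquivOfSurjective (toExt_surj P Y n))

lemma fl_iff (N M : ModuleCat.{u} R) (j : ℕ) :
    IsFiniteLength R (((Ext R (ModuleCat.{u} R) j).obj (Opposite.op N)).obj M) ↔
      IsFiniteLength R (Abelian.Ext.{u} N M j) :=
  ⟨(extEquiv (projectiveResolution N) M j).isFiniteLength,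
   (extEquiv (projectiveResolution N) M j).symm.isFiniteLength⟩

lemma fl_of_exact {A B C : Type*} [AddCommGroup A] [AddCommGroup B] [AddCommGroup C]
    [Module R A] [Module R B] [Module R C] (f : A →ₗ[R] B) (g : B →ₗ[R] C)
    (h : ∀ x, g x = 0 → ∃ y, f y = x) (hA : IsFiniteLength R A) (hC : IsFiniteLength R C) :
    IsFiniteLength R B := by
  rw [isFiniteLength_iff_isNoetherian_isArtinian] at *
  obtain ⟨_, _⟩ := hA
  obtain ⟨_, _⟩ := hC
  have hr : LinearMap.ker g ≤ LinearMap.range f := fun x hx => h x hx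
  have e := g.quotKerEquivRange
  have n1 : IsNoetherian R (LinearMap.ker g) :=
    isNoetherian_of_injective _ (Submodule.inclusion_injective hr)
  have n2 : IsArtinian R (LinearMap.ker g) :=
    isArtinian_of_injective _ (Submodule.inclusion_injective hr)
  have n3 : IsNoetherian R (B ⧸ LinearMap.ker g) := isNoetherian_of_linearEquiv e.symm
  have n4 : IsArtinian R (B ⧸ LinearMap.ker g) := e.isArtinian_iff.mpr inferInstance
  exact ⟨(isNoetherian_iff_submodule_quotient (LinearMap.ker g)).mpr ⟨n1, n3⟩,
    (isArtinian_iff_submodule_quotient (LinearMap.ker g)).mpr ⟨n2, n4⟩⟩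

lemma simple_equiv [IsLocalRing R] (S : Type u) [AddCommGroup S] [Module R S]
    [IsSimpleModule R S] : Nonempty (S ≃ₗ[R] ResidueField R) := by
  obtain ⟨I, hI, ⟨e⟩⟩ := isSimpleModule_iff_quot_maximal.mp ‹IsSimpleModule R S›
  obtain rfl := IsLocalRing.eq_maximalIdeal hI
  exact ⟨e⟩

def Fl (M N : ModuleCat.{u} R) (j : ℕ) : Prop := IsFiniteLength R (Abelian.Ext.{u} N M j)

lemma fl_congr {M N N' : ModuleCat.{u} R} (e : N ≅ N') (j : ℕ) (h : Fl M N j) : Fl M N' j := by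
  refine IsFiniteLength.of_injective (f := (Ext.mk₀ e.hom).precompOfLinear R M (zero_add j)) h ?_
  intro x y hxy
  have h2 := congrArg (fun z => (Ext.mk₀ e.inv).comp z (zero_add j)) hxy
  simpa using h2

lemma quot_shortExact (N : Type u) [AddCommGroup N] [Module R N] (S : Submodule R N) :
    (ShortComplex.moduleCatMk S.subtype S.mkQ (by ext; simp)).ShortExact :=
  ModuleCat.shortComplex_shortExact _ (LinearMap.exact_subtype_mkQ S) S.injective_subtype
    S.mkQ_surjective

/-- finite length Ext from the residue field implies the same for all finite length modules,
at fixed degree. -/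
lemma fl_all [IsLocalRing R] (M : ModuleCat.{u} R) (j : ℕ)
    (h : Fl M (ModuleCat.of R (ResidueField R)) j) (N : Type u) [AddCommGroup N] [Module R N]
    (hN : IsFiniteLength R N) : Fl M (ModuleCat.of R N) j := by
  induction hN with
  | @of_subsingleton N _ _ _ =>
    have : Subsingleton (Abelian.Ext.{u} (ModuleCat.of R N) M j) := by
      refine subsingleton_of_forall_eq 0 fun x => ?_
      have hz : Limits.IsZero (ModuleCat.of R N) := ModuleCat.isZero_of_subsingleton _
      rw [← Ext.mk₀_id_comp x, hz.eq_of_src (𝟙 _) 0, Ext.mk₀_zero, Ext.zero_comp]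
    exact .of_subsingleton
  | @of_simple_quotient N _ _ S _ _ ih =>
    have hS := quot_shortExact N S
    obtain ⟨e⟩ := simple_equiv (R := R) (N ⧸ S)
    have hq : Fl M (ModuleCat.of R (N ⧸ S)) j := fl_congr e.symm.toModuleIso j h
    exact fl_of_exact ((Ext.mk₀ (ModuleCat.ofHom S.mkQ)).precompOfLinear R M (zero_add j))
      ((Ext.mk₀ (ModuleCat.ofHom S.subtype)).precompOfLinear R M (zero_add j))
      (fun x hx => Ext.contravariant_sequence_exact₂ hS M x hx) hq ih

lemma fl_residue [IsLocalRing R] (M : ModuleCat.{u} R) (N : Type u) [AddCommGroup N] [Module R N]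
    [Nontrivial N] (hN : IsFiniteLength R N) (h : ∀ j, Fl M (ModuleCat.of R N) j) (j : ℕ) :
    Fl M (ModuleCat.of R (ResidueField R)) j := by
  obtain ⟨S, hs, hSl⟩ : ∃ S : Submodule R N, IsSimpleModule R (N ⧸ S) ∧ IsFiniteLength R S := by
    cases hN with
    | @of_subsingleton _ _ _ hsub => exact (not_subsingleton N hsub).elim
    | @of_simple_quotient _ _ _ S hs hl => exact ⟨S, hs, hl⟩
  have hS := quot_shortExact N S
  obtain ⟨e⟩ := simple_equiv (R := R) (N ⧸ S)
  induction j with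
  | zero =>
    refine fl_congr e.toModuleIso 0 ?_
    have : Epi (ModuleCat.ofHom S.mkQ) := hS.epi_g
    exact IsFiniteLength.of_injective
      (f := (Ext.mk₀ (ModuleCat.ofHom S.mkQ)).precompOfLinear R M (zero_add 0)) (h 0)
      (Ext.precomp_mk₀_injective_of_epi M (ModuleCat.ofHom S.mkQ))
  | succ j ih =>
    refine fl_congr e.toModuleIso (j+1) ?_
    have hS' : Fl M (ModuleCat.of R S) j := fl_all M j ih S hSl
    exact fl_of_exact (hS.extClass.precompOfLinear R M (add_comm 1 j))
      ((Ext.mk₀ (ModuleCat.ofHom S.mkQ)).precompOfLinear R M (zero_add (j+1)))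
      (fun x hx => Ext.contravariant_sequence_exact₃ hS M x hx (add_comm 1 j)) hS' (h (j+1))

end BassAux

theorem tfae_finite_bass_numbers
    (R : Type u) [CommRing R] [IsLocalRing R] [IsNoetherianRing R]
    (M : Type u) [AddCommGroup M] [Module R M] :
    List.TFAE
      [ ∀ j : ℕ, IsFiniteLength R
          (((Ext R (ModuleCat.{u} R) j).obj
            (Opposite.op (ModuleCat.of R (ResidueField R)))).obj (ModuleCat.of R M)),
        ∀ N : ModuleCat.{u} R, IsFiniteLength R N → ∀ j : ℕ, IsFiniteLength R
          (((Ext R (ModuleCat.{u} R) j).obj (Opposite.op N)).obj (ModuleCat.of R M)),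
        ∃ N : ModuleCat.{u} R, Nontrivial N ∧ IsFiniteLength R N ∧ ∀ j : ℕ, IsFiniteLength R
          (((Ext R (ModuleCat.{u} R) j).obj (Opposite.op N)).obj (ModuleCat.of R M)) ] := by
  simp only [BassAux.fl_iff]
  tfae_have 1 → 2 := fun h N hN j => BassAux.fl_all (ModuleCat.of R M) j (h j) N hN
  tfae_have 2 → 3 := fun h => by
    have hK : IsFiniteLength R (ResidueField R) := by
      have : IsSimpleModule R (ResidueField R) :=
        isSimpleModule_iff_quot_maximal.mpr ⟨maximalIdeal R, inferInstance, ⟨LinearEquiv.refl _ _⟩⟩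
      exact isFiniteLength_iff_isNoetherian_isArtinian.mpr ⟨inferInstance, inferInstance⟩
    exact ⟨ModuleCat.of R (ResidueField R), inferInstanceAs (Nontrivial (ResidueField R)), hK,
      h _ hK⟩
  tfae_have 3 → 1 := fun ⟨N, _, hN, h⟩ => BassAux.fl_residue (ModuleCat.of R M) N hN h
  tfae_finish
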